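/- arXiv:2408.12927 — 2 statements merged into one kernel-verified Lean document; each statement's English description precedes it below -/
import Mathlib

section
/- Let X be any partial rank matrix with n voters and m candidates such that w is a necessary Borda winner of X (i.e., w ∈ Borda(R') for every complete extension R' of X). Then |X| ≥ n − ⌊n/m⌋. -/
section Defs

variable {n m : ℕ} {C : Type*}

/-- A partial row (partial ballot): each candidate appears at most once. -/
def IsPartialRow (r : Fin m → Option C) : Prop :=
  ∀ ⦃k k' : Fin m⦄ ⦃c : C⦄, r k = some c → r k' = some c → k = k'

/-- `q` is a completion of the partial row `r` (a bijection from positions to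
candidates agreeing with `r` on all non-null entries). -/
def IsCompletion (r : Fin m → Option C) (q : Fin m ≃ C) : Prop :=
  ∀ ⦃k : Fin m⦄ ⦃c : C⦄, r k = some c → q k = c

/-- Number of non-null (locked) entries of a partial row. -/
def rowSize (r : Fin m → Option C) : ℕ :=
  (Finset.univ.filter fun k : Fin m => (r k).isSome).card

/-- A partial rank matrix: each candidate appears at most once in every row. -/
def IsPartialMat (R : Fin n → Fin m → Option C) : Prop :=
  ∀ i, IsPartialRow (R i)

/-- `Q` is a complete extension of the partial rank matrix `R`:
each row of `Q` is a bijection from positions to candidates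
agreeing with the corresponding row of `R` on all non-null entries. -/
def IsMatCompletion (R : Fin n → Fin m → Option C) (Q : Fin n → Fin m ≃ C) : Prop :=
  ∀ i, IsCompletion (R i) (Q i)

/-- Number of non-null (locked) entries of a partial rank matrix. -/
def matSize (R : Fin n → Fin m → Option C) : ℕ := ∑ i, rowSize (R i)

/-- `R ⊆ R'` : the partial rank matrix `R'` extends the partial rank matrix `R`. -/
def PExt (R R' : Fin n → Fin m → Option C) : Prop :=
  ∀ i k c, R i k = some c → R' i k = some c

/-- `w` is a necessary winner of the partial rank matrix `X` under voting rule `F`. -/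
def NecessaryWinner (F : (Fin n → Fin m ≃ C) → Set C)
    (X : Fin n → Fin m → Option C) (w : C) : Prop :=
  ∀ Q : Fin n → Fin m ≃ C, IsMatCompletion X Q → w ∈ F Q

/-- `R∖Y` : the partial rank matrix obtained from the complete rank matrix `R` by
erasing (making null) the entries locked in `Y`. -/
def matDiff (R : Fin n → Fin m ≃ C) (Y : Fin n → Fin m → Option C) :
    Fin n → Fin m → Option C :=
  fun i k => if (Y i k).isSome then none else some (R i k)

/-- Borda score of candidate `c` in the complete row `q` :
a candidate in position `k+1` (index `k`) scores `m - (k+1)`. -/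
def bordaRowScore (q : Fin m ≃ C) (c : C) : ℤ := (m : ℤ) - 1 - ((q.symm c : ℕ) : ℤ)

/-- Minimal Borda score of `c` over all completions of the partial row `r`. -/
noncomputable def rowSMin (r : Fin m → Option C) (c : C) : ℤ :=
  sInf {x : ℤ | ∃ q : Fin m ≃ C, IsCompletion r q ∧ bordaRowScore q c = x}

/-- Maximal Borda score of `c` over all completions of the partial row `r`. -/
noncomputable def rowSMax (r : Fin m → Option C) (c : C) : ℤ :=
  sSup {x : ℤ | ∃ q : Fin m ≃ C, IsCompletion r q ∧ bordaRowScore q c = x}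

/-- Total score margin `Δ(r) = Σ_{c' ≠ w} (σmin_r(w) − σmax_r(c'))` of `w` in the
partial row `r`, under Borda weights. -/
noncomputable def rowDelta [Fintype C] [DecidableEq C]
    (r : Fin m → Option C) (w : C) : ℤ :=
  ∑ c ∈ Finset.univ.filter (fun c : C => c ≠ w), (rowSMin r w - rowSMax r c)

/-- Borda score of candidate `c` in the complete rank matrix `Q`. -/
def bordaScore (Q : Fin n → Fin m ≃ C) (c : C) : ℤ := ∑ i, bordaRowScore (Q i) c

/-- `w ∈ Borda(Q)` : `w` has maximal Borda score in the complete rank matrix `Q`. -/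
def IsBordaWinner (Q : Fin n → Fin m ≃ C) (w : C) : Prop :=
  ∀ c, bordaScore Q c ≤ bordaScore Q w

/-- Score of candidate `c` in the complete rank matrix `Q` under the scoring rule
with weight vector `wt`. -/
def scoreW (wt : Fin m → ℝ) (Q : Fin n → Fin m ≃ C) (c : C) : ℝ :=
  ∑ i, wt ((Q i).symm c)

/-- `σmin_R(c)` : minimal score of `c` over all complete extensions of `R`. -/
noncomputable def matSMinW (wt : Fin m → ℝ) (R : Fin n → Fin m → Option C) (c : C) : ℝ :=
  sInf {x : ℝ | ∃ Q : Fin n → Fin m ≃ C, IsMatCompletion R Q ∧ scoreW wt Q c = x}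

/-- `σmax_R(c)` : maximal score of `c` over all complete extensions of `R`. -/
noncomputable def matSMaxW (wt : Fin m → ℝ) (R : Fin n → Fin m → Option C) (c : C) : ℝ :=
  sSup {x : ℝ | ∃ Q : Fin n → Fin m ≃ C, IsMatCompletion R Q ∧ scoreW wt Q c = x}

/-- `σmin_{R_i}(c)` : minimal score of `c` over all completions of the single row `r`. -/
noncomputable def rowSMinW (wt : Fin m → ℝ) (r : Fin m → Option C) (c : C) : ℝ :=
  sInf {x : ℝ | ∃ q : Fin m ≃ C, IsCompletion r q ∧ wt (q.symm c) = x}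

/-- `σmax_{R_i}(c)` : maximal score of `c` over all completions of the single row `r`. -/
noncomputable def rowSMaxW (wt : Fin m → ℝ) (r : Fin m → Option C) (c : C) : ℝ :=
  sSup {x : ℝ | ∃ q : Fin m ≃ C, IsCompletion r q ∧ wt (q.symm c) = x}

/-- `r` is in normal form of parameters `k1, k2`: a position `p = k+1` is null
exactly when `k1 < p < m + 1 - k2`. -/
def IsNormalForm (r : Fin m → Option C) (k1 k2 : ℕ) : Prop :=
  ∀ k : Fin m, r k = none ↔ (k1 < (k : ℕ) + 1 ∧ (k : ℕ) + 1 < m + 1 - k2)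

end Defs

/-- Every partial row can be completed. -/
lemma IsPartialRow.exists_isCompletion {m : ℕ} {C : Type*} [Fintype C] [DecidableEq C]
    (hC : Fintype.card C = m) {r : Fin m → Option C} (hr : IsPartialRow r) :
    ∃ q : Fin m ≃ C, IsCompletion r q := by
  classical
  obtain ⟨e⟩ : Nonempty (Fin m ≃ C) := ⟨(Fintype.equivFinOfCardEq hC).symm⟩
  let f : Fin m → C := fun k => (r k).getD (e k)
  have hf : Set.InjOn f (Finset.univ.filter fun k : Fin m => (r k).isSome) := by
    intro a ha b hb hab
    simp only [Finset.coe_filter, Finset.mem_univ, true_and, Set.mem_ofPred_eq,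
      Option.isSome_iff_exists] at ha hb
    obtain ⟨x, hx⟩ := ha
    obtain ⟨y, hy⟩ := hb
    simp only [f, hx, hy, Option.getD_some] at hab
    exact hr hx (hab ▸ hy)
  obtain ⟨g, hg⟩ := Finset.exists_equiv_extend_of_card_eq (t := (Finset.univ : Finset C))
    (by simp [hC]) (Finset.subset_univ _) hf
  refine ⟨g.trans (Equiv.subtypeUnivEquiv Finset.mem_univ), fun k c hk => ?_⟩
  simpa [f, hk, Equiv.subtypeUnivEquiv] using hg k (by simp [hk])

/-- Locking an absent candidate at a position keeps the row a partial row. -/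
lemma IsPartialRow.update {m : ℕ} {C : Type*} {r : Fin m → Option C} (hr : IsPartialRow r)
    (p : Fin m) {c : C} (hc : ∀ k, r k ≠ some c) :
    IsPartialRow (Function.update r p (some c)) := by
  intro a b x ha hb
  have := @hr a b x
  have := hc a
  have := hc b
  grind [Function.update_apply]

/-- Completions of a row with one more null position locked are completions of the row. -/
lemma IsCompletion.of_update {m : ℕ} {C : Type*} {r : Fin m → Option C} {p : Fin m} {c : C}
    {q : Fin m ≃ C} (hq : IsCompletion (Function.update r p (some c)) q) (hp : r p = none) :
    IsCompletion r q ∧ q.symm c = p := by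
  refine ⟨fun k x hk => hq ?_, ?_⟩
  · rw [Function.update_of_ne (by rintro rfl; simp [hp] at hk), hk]
  · rw [Equiv.symm_apply_eq]
    exact (hq (by simp)).symm

lemma bordaRowScore_nonneg {m : ℕ} {C : Type*} (q : Fin m ≃ C) (c : C) :
    0 ≤ bordaRowScore q c := by
  have := (q.symm c).isLt
  unfold bordaRowScore
  omega

lemma bordaRowScore_le {m : ℕ} {C : Type*} (q : Fin m ≃ C) (c : C) :
    bordaRowScore q c ≤ m - 1 := by
  unfold bordaRowScore
  omega

/-- A row with no locked entry can be completed with `w` a full `m - 1` points behind `c`, and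
each locked entry raises this margin by at most `m`. -/
lemma IsPartialRow.exists_isCompletion_margin_le {m : ℕ} {C : Type*} [Fintype C] [DecidableEq C]
    (hm : 2 ≤ m) (hC : Fintype.card C = m) {r : Fin m → Option C} (hr : IsPartialRow r)
    {w c : C} (hcw : c ≠ w) :
    ∃ q : Fin m ≃ C, IsCompletion r q ∧
      bordaRowScore q w - bordaRowScore q c ≤ m * rowSize r - (m - 1) := by
  obtain h0 | h1 | h2 : rowSize r = 0 ∨ rowSize r = 1 ∨ 2 ≤ rowSize r := by omega
  · have hnone : ∀ k, r k = none := by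
      simpa [rowSize, Finset.filter_eq_empty_iff] using h0
    let first : Fin m := ⟨0, by omega⟩
    let last : Fin m := ⟨m - 1, by omega⟩
    have hne : last ≠ first := by simp only [ne_eq, Fin.ext_iff, first, last]; omega
    have hw := hr.update last (c := w) (by simp [hnone])
    have hwc := hw.update first (c := c) (by
      intro k
      by_cases hk : k = last <;> simp [hk, hnone, hcw.symm])
    obtain ⟨q, hq⟩ := hwc.exists_isCompletion hC
    obtain ⟨hq, hqc⟩ := hq.of_update (by simp [hne.symm, hnone])
    obtain ⟨hq, hqw⟩ := hq.of_update (hnone _)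
    refine ⟨q, hq, ?_⟩
    simp only [bordaRowScore, hqc, hqw, h0, first, last]
    push_cast
    omega
  · obtain ⟨p, hp⟩ := Finset.card_eq_one.mp h1
    have hiff : ∀ k, (r k).isSome ↔ k = p := by
      intro k
      simpa using Finset.ext_iff.mp hp k
    have hnone : ∀ k, k ≠ p → r k = none := by
      intro k hk
      simpa using mt (hiff k).mp hk
    obtain ⟨x, hx⟩ := Option.isSome_iff_exists.mp ((hiff p).mpr rfl)
    have habs : ∀ y, x ≠ y → ∀ k, r k ≠ some y := by
      intro y hy k hk
      by_cases hkp : k = p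
      · subst hkp
        exact hy (Option.some.inj (hx.symm.trans hk))
      · simp [hnone k hkp] at hk
    rw [h1]
    by_cases hxw : x = w
    · obtain ⟨k, hkp, hk⟩ : ∃ k : Fin m, k ≠ p ∧ (k : ℕ) ≤ 1 := by
        by_cases hp0 : (p : ℕ) = 0
        · exact ⟨⟨1, by omega⟩, by simp only [ne_eq, Fin.ext_iff]; omega, le_rfl⟩
        · exact ⟨⟨0, by omega⟩, by simp only [ne_eq, Fin.ext_iff]; omega, by simp⟩
      obtain ⟨q, hq⟩ :=
        (hr.update k (habs c (by rw [hxw]; exact hcw.symm))).exists_isCompletion hC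
      obtain ⟨hq, hqc⟩ := hq.of_update (hnone k hkp)
      refine ⟨q, hq, ?_⟩
      have := bordaRowScore_le q w
      have : bordaRowScore q c = m - 1 - (k : ℕ) := by rw [bordaRowScore, hqc]
      push_cast
      omega
    · obtain ⟨k, hkp, hk⟩ : ∃ k : Fin m, k ≠ p ∧ m - 2 ≤ (k : ℕ) := by
        by_cases hpl : (p : ℕ) = m - 1
        · exact ⟨⟨m - 2, by omega⟩, by simp only [ne_eq, Fin.ext_iff]; omega, le_rfl⟩
        · exact ⟨⟨m - 1, by omega⟩, by simp only [ne_eq, Fin.ext_iff]; omega,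
            by simp only; omega⟩
      obtain ⟨q, hq⟩ := (hr.update k (habs w hxw)).exists_isCompletion hC
      obtain ⟨hq, hqw⟩ := hq.of_update (hnone k hkp)
      refine ⟨q, hq, ?_⟩
      have := bordaRowScore_nonneg q c
      have : bordaRowScore q w = m - 1 - (k : ℕ) := by rw [bordaRowScore, hqw]
      push_cast
      omega
  · obtain ⟨q, hq⟩ := hr.exists_isCompletion hC
    refine ⟨q, hq, ?_⟩
    have := bordaRowScore_le q w
    have := bordaRowScore_nonneg q c
    have : (2 : ℤ) ≤ rowSize r := by exact_mod_cast h2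
    nlinarith

/- STATEMENT 5 -/
theorem stmt5 {n m : ℕ} {C : Type*} [Fintype C] [DecidableEq C]
    (hn : 1 ≤ n) (hm : 2 ≤ m) (hC : Fintype.card C = m)
    (X : Fin n → Fin m → Option C) (hX : IsPartialMat X) (w : C)
    (hNW : ∀ Q : Fin n → Fin m ≃ C, IsMatCompletion X Q → IsBordaWinner Q w) :
    n - n / m ≤ matSize X := by
  obtain ⟨c, hcw⟩ : ∃ c : C, c ≠ w := Fintype.exists_ne_of_one_lt_card (by omega) w
  choose Q hQ hmargin using fun i => (hX i).exists_isCompletion_margin_le hm hC hcw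
  have hsum := Finset.sum_le_sum fun i (_ : i ∈ Finset.univ) => hmargin i
  have hwin := hNW Q hQ c
  simp only [Finset.sum_sub_distrib, ← Finset.mul_sum, Finset.sum_const, Finset.card_univ,
    Fintype.card_fin, nsmul_eq_mul, ← Nat.cast_sum] at hsum
  simp only [bordaScore] at hwin
  change _ ≤ (m : ℤ) * (matSize X : ℕ) - _ at hsum
  by_cases hle : n ≤ matSize X
  · exact (Nat.sub_le _ _).trans hle
  have hdiv : n - matSize X ≤ n / m := by
    rw [Nat.le_div_iff_mul_le (by omega)]
    zify [not_le.mp hle |>.le]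
    linarith
  omega
end

section
/- Let X be any partial rank matrix with n voters and m candidates and w any candidate. Then the total margin of victory of w under Borda satisfies Δ(X) = Σ_{i=1}^n Δ(X_i) ≤ (m − 1)·(m·|X| − n·(m − 1)). -/
section RowBounds

variable {m : ℕ} {C : Type*}

lemma rowSMin_le (r : Fin m → Option C) {q : Fin m ≃ C} (hq : IsCompletion r q) (c : C) :
    rowSMin r c ≤ bordaRowScore q c := by
  refine csInf_le ⟨0, ?_⟩ ⟨q, hq, rfl⟩
  rintro _ ⟨p, -, rfl⟩
  have := (p.symm c).isLt
  unfold bordaRowScore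
  omega

lemma le_rowSMax (r : Fin m → Option C) {q : Fin m ≃ C} (hq : IsCompletion r q) (c : C) :
    bordaRowScore q c ≤ rowSMax r c := by
  refine le_csSup ⟨m, ?_⟩ ⟨q, hq, rfl⟩
  rintro _ ⟨p, -, rfl⟩
  unfold bordaRowScore
  omega

/-- Every partial row has a completion. -/
lemma IsPartialRow.exists_completion [Fintype C] (hC : Fintype.card C = m)
    {r : Fin m → Option C} (hr : IsPartialRow r) : ∃ q : Fin m ≃ C, IsCompletion r q := by
  classical
  let e : Fin m ≃ C := Fintype.equivOfCardEq (by simp [hC])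
  let f : Fin m → C := fun k => (r k).getD (e k)
  obtain ⟨g, hg⟩ := Finset.exists_equiv_extend_of_card_eq (t := (Finset.univ : Finset C))
    (by simp [hC]) (s := Finset.univ.filter fun k => (r k).isSome) (f := f)
    (by simp) (by
      intro k hk k' hk' h
      obtain ⟨c, hc⟩ := Option.isSome_iff_exists.1 (by simpa using hk)
      obtain ⟨c', hc'⟩ := Option.isSome_iff_exists.1 (by simpa using hk')
      obtain rfl : c = c' := by simpa [f, hc, hc'] using h
      exact hr hc hc')
  refine ⟨g.trans (Equiv.subtypeUnivEquiv fun _ => Finset.mem_univ _), fun k c hk => ?_⟩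
  simpa [f, hk] using hg k (by simp [hk])

/-- A candidate not yet ranked can be placed at any free position. -/
lemma IsPartialRow.exists_completion_symm_eq [Fintype C] (hC : Fintype.card C = m)
    {r : Fin m → Option C} (hr : IsPartialRow r) {k : Fin m} {c : C} (hk : r k = none)
    (hc : ∀ j, r j ≠ some c) : ∃ q : Fin m ≃ C, IsCompletion r q ∧ q.symm c = k := by
  classical
  have hr' : IsPartialRow (Function.update r k (some c)) := by
    intro i j d hi hj
    by_cases h1 : i = k <;> by_cases h2 : j = k <;>
      simp only [Function.update_apply, h1, h2, if_true, if_false] at hi hj ⊢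
    · exact absurd (hj.trans hi.symm) (hc j)
    · exact absurd (hi.trans hj.symm) (hc i)
    · exact hr hi hj
  obtain ⟨q, hq⟩ := hr'.exists_completion hC
  refine ⟨q, fun j d hj => hq ?_, ?_⟩
  · have : j ≠ k := by rintro rfl; simp [hk] at hj
    simpa [this] using hj
  · rw [Equiv.symm_apply_eq]
    exact (hq (by simp)).symm

lemma rowSMin_sub_rowSMax_le [Fintype C] (hm : 2 ≤ m) (hC : Fintype.card C = m)
    {r : Fin m → Option C} (hr : IsPartialRow r) {w c : C} (hcw : c ≠ w) :
    rowSMin r w - rowSMax r c ≤ (m : ℤ) * rowSize r - ((m : ℤ) - 1) := by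
  obtain ⟨q, hq⟩ := hr.exists_completion hC
  have hw := rowSMin_le r hq w
  have hc := le_rowSMax r hq c
  have hcm := (q.symm c).isLt
  obtain hs | hs | hs : rowSize r = 0 ∨ rowSize r = 1 ∨ 2 ≤ rowSize r := by omega
  · have hnone : ∀ k, r k = none := by
      simpa [rowSize, Finset.filter_eq_empty_iff] using hs
    obtain ⟨p, hp, hpw⟩ := hr.exists_completion_symm_eq hC
      (hnone ⟨m - 1, by omega⟩) (c := w) (by simp [hnone])
    obtain ⟨p', hp', hpc⟩ := hr.exists_completion_symm_eq hC
      (hnone ⟨0, by omega⟩) (c := c) (by simp [hnone])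
    have h1 := rowSMin_le r hp w
    have h2 := le_rowSMax r hp' c
    simp only [bordaRowScore, hpw, hpc] at h1 h2
    rw [hs]
    push_cast
    omega
  · obtain ⟨a, ha⟩ := Finset.card_eq_one.1 hs
    have hsome : ∀ k, (r k).isSome ↔ k = a := fun k => by
      simpa using congrArg (k ∈ ·) ha
    have hnone : ∀ k, k ≠ a → r k = none := fun k hk => by
      simpa [hk] using (hsome k).not
    have hne : ∀ d j, r a ≠ some d → r j ≠ some d := by
      intro d j hd
      by_cases hj : j = a
      · rwa [hj]
      · simp [hnone j hj]
    rw [hs]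
    by_cases hac : r a = some c
    · obtain ⟨k, hka, hk⟩ : ∃ k : Fin m, k ≠ a ∧ m ≤ (k : ℕ) + 2 := by
        by_cases h : (a : ℕ) = m - 1
        · exact ⟨⟨m - 2, by omega⟩, by simp [Fin.ext_iff]; omega, by simp; omega⟩
        · exact ⟨⟨m - 1, by omega⟩, by simp [Fin.ext_iff]; omega, by simp; omega⟩
      obtain ⟨p, hp, hpw⟩ := hr.exists_completion_symm_eq hC (hnone k hka)
        (fun j => hne w j (by simpa [hac] using hcw))
      have h1 := rowSMin_le r hp w
      simp only [bordaRowScore, hpw] at h1 hc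
      push_cast
      omega
    · obtain ⟨k, hka, hk⟩ : ∃ k : Fin m, k ≠ a ∧ (k : ℕ) ≤ 1 := by
        by_cases h : (a : ℕ) = 0
        · exact ⟨⟨1, by omega⟩, by simp [Fin.ext_iff]; omega, by simp⟩
        · exact ⟨⟨0, by omega⟩, by simp [Fin.ext_iff]; omega, by simp⟩
      obtain ⟨p, hp, hpc⟩ := hr.exists_completion_symm_eq hC (hnone k hka)
        (fun j => hne c j hac)
      have h2 := le_rowSMax r hp c
      simp only [bordaRowScore, hpc] at h2 hw
      push_cast
      omega
  · have : (m : ℤ) * 2 ≤ m * rowSize r := by gcongr; exact_mod_cast hs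
    simp only [bordaRowScore] at hw hc
    omega

lemma rowDelta_le [Fintype C] [DecidableEq C] (hm : 2 ≤ m) (hC : Fintype.card C = m)
    {r : Fin m → Option C} (hr : IsPartialRow r) (w : C) :
    rowDelta r w ≤ ((m : ℤ) - 1) * ((m : ℤ) * rowSize r - ((m : ℤ) - 1)) := by
  refine (Finset.sum_le_card_nsmul _ _ ((m : ℤ) * rowSize r - ((m : ℤ) - 1)) fun c hc =>
    rowSMin_sub_rowSMax_le hm hC hr (by simpa using hc)).trans_eq ?_
  rw [Finset.filter_ne', Finset.card_erase_of_mem (Finset.mem_univ w), Finset.card_univ, hC,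
    nsmul_eq_mul, Nat.cast_sub (by omega), Nat.cast_one]

end RowBounds

/- STATEMENT 15 -/
theorem stmt15 {n m : ℕ} {C : Type*} [Fintype C] [DecidableEq C]
    (hn : 1 ≤ n) (hm : 2 ≤ m) (hC : Fintype.card C = m)
    (X : Fin n → Fin m → Option C) (hX : IsPartialMat X) (w : C) :
    (∑ i : Fin n, rowDelta (X i) w)
      ≤ ((m : ℤ) - 1) * ((m : ℤ) * (matSize X : ℤ) - (n : ℤ) * ((m : ℤ) - 1)) := by
  refine (Finset.sum_le_sum fun i _ => rowDelta_le hm hC (hX i) w).trans_eq ?_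
  simp only [matSize, ← Finset.mul_sum, Finset.sum_sub_distrib, Finset.sum_const,
    Finset.card_univ, Fintype.card_fin, nsmul_eq_mul, Nat.cast_sum]
  ring
end
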